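/- arXiv:1808.09475 — 4 statements merged into one kernel-verified Lean document; each statement's English description precedes it below -/
import Mathlib

section
/- For every integer n ≥ 2, the treewidth of the stacked prism graph Y_{2n,n} is at least 2n − 1. -/
open SimpleGraph

/-- A tree decomposition of a graph `G`: a tree `tree` on node type `ι` with a bag of
vertices of `G` at each node, such that every vertex lies in some bag, both endpoints of
every edge lie in a common bag, and for each vertex the set of nodes whose bags contain it
induces a connected subgraph of the tree. -/
structure TreeDecomp {V : Type*} (G : SimpleGraph V) where
  ι : Type
  tree : SimpleGraph ι
  isTree : tree.IsTree
  bag : ι → Set V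
  bag_cover : ∀ v : V, ∃ t, v ∈ bag t
  bag_edge : ∀ ⦃u v : V⦄, G.Adj u v → ∃ t, u ∈ bag t ∧ v ∈ bag t
  bag_conn : ∀ v : V, (tree.induce {t | v ∈ bag t}).Connected

/-- The treewidth of `G`: the least `k` such that some tree decomposition of `G` has all
bags of size at most `k + 1` (i.e. the minimum over tree decompositions of one less than
the maximum bag size). -/
noncomputable def treewidth {V : Type*} (G : SimpleGraph V) : ℕ :=
  sInf {k : ℕ | ∃ D : TreeDecomp G, ∀ t, (D.bag t).ncard ≤ k + 1}

/-- Two vertex sets touch if their union induces a connected subgraph. -/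
def Touches {V : Type*} (G : SimpleGraph V) (A B : Set V) : Prop :=
  (G.induce (A ∪ B)).Connected

/-- A bramble: a family of vertex sets, each inducing a connected subgraph,
that pairwise touch. -/
structure IsBramble {V : Type*} (G : SimpleGraph V) (ℬ : Set (Set V)) : Prop where
  conn : ∀ B ∈ ℬ, (G.induce B).Connected
  touch : ∀ A ∈ ℬ, ∀ B ∈ ℬ, Touches G A B

/-- A strict bramble: a bramble any two of whose members share a vertex. -/
def IsStrictBramble {V : Type*} (G : SimpleGraph V) (ℬ : Set (Set V)) : Prop :=
  IsBramble G ℬ ∧ ∀ A ∈ ℬ, ∀ B ∈ ℬ, (A ∩ B).Nonempty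

/-- A hitting set for a family of vertex sets: a set meeting every member. -/
def IsHittingSet {V : Type*} (ℬ : Set (Set V)) (S : Set V) : Prop :=
  ∀ B ∈ ℬ, (S ∩ B).Nonempty

/-- The order of a bramble: the minimum size of a hitting set. -/
noncomputable def brambleOrder {V : Type*} (ℬ : Set (Set V)) : ℕ :=
  sInf {k : ℕ | ∃ S : Set V, IsHittingSet ℬ S ∧ S.ncard = k}

/-- The bramble number of `G`: the maximum order of a bramble on `G`. -/
noncomputable def brambleNumber {V : Type*} (G : SimpleGraph V) : ℕ :=
  sSup {k : ℕ | ∃ ℬ, IsBramble G ℬ ∧ brambleOrder ℬ = k}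

/-- The strict bramble number of `G`: the maximum order of a strict bramble on `G`. -/
noncomputable def strictBrambleNumber {V : Type*} (G : SimpleGraph V) : ℕ :=
  sSup {k : ℕ | ∃ ℬ, IsStrictBramble G ℬ ∧ brambleOrder ℬ = k}

/-- The `m × n` grid graph `P_m □ P_n`. -/
def gridGraph (m n : ℕ) : SimpleGraph (Fin m × Fin n) :=
  SimpleGraph.pathGraph m □ SimpleGraph.pathGraph n

/-- The stacked prism graph `Y_{m,n} = C_m □ P_n`. -/
def stackedPrism (m n : ℕ) : SimpleGraph (Fin m × Fin n) :=
  SimpleGraph.cycleGraph m □ SimpleGraph.pathGraph n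

/-- The toroidal grid graph `T_{m,n} = C_m □ C_n`. -/
def toroidalGrid (m n : ℕ) : SimpleGraph (Fin m × Fin n) :=
  SimpleGraph.cycleGraph m □ SimpleGraph.cycleGraph n

/-- `H` is a minor of `G`: there are pairwise disjoint nonempty connected branch sets in `G`,
one for each vertex of `H`, with an edge of `G` between the branch sets of any two vertices
adjacent in `H`. -/
def IsGraphMinor {W V : Type*} (H : SimpleGraph W) (G : SimpleGraph V) : Prop :=
  ∃ B : W → Set V,
    (∀ w, (B w).Nonempty) ∧
    (∀ w, (G.induce (B w)).Connected) ∧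
    (∀ w₁ w₂, w₁ ≠ w₂ → Disjoint (B w₁) (B w₂)) ∧
    (∀ ⦃w₁ w₂⦄, H.Adj w₁ w₂ → ∃ v₁ ∈ B w₁, ∃ v₂ ∈ B w₂, G.Adj v₁ v₂)

open Classical in
/-- The chip-firing move at a vertex `v`: `v` loses one chip along each incident edge,
each neighbor of `v` gains one chip. -/
noncomputable def fireVertex {V : Type*} (G : SimpleGraph V) (D : V → ℤ) (v : V) : V → ℤ :=
  fun u => if u = v then D u - (G.neighborSet v).ncard
    else if G.Adj v u then D u + 1 else D u

/-- Two divisors on `G` are equivalent if one is obtained from the other by a finite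
sequence of chip-firing moves. -/
def ChipEquiv {V : Type*} (G : SimpleGraph V) : (V → ℤ) → (V → ℤ) → Prop :=
  Relation.EqvGen (fun D D' => ∃ v, D' = fireVertex G D v)

/-- A divisor `D` wins the gonality game on `G` if for every vertex `q`, the divisor
`D - q` is equivalent to an effective divisor. -/
def WinsGonalityGame {V : Type*} [DecidableEq V] (G : SimpleGraph V) (D : V → ℤ) : Prop :=
  ∀ q : V, ∃ E : V → ℤ, (∀ v, 0 ≤ E v) ∧
    ChipEquiv G (fun v => D v - if v = q then 1 else 0) E

/-- The divisorial gonality of `G`: the least degree of an effective divisor winning the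
gonality game. -/
noncomputable def gonality {V : Type*} [Fintype V] [DecidableEq V] (G : SimpleGraph V) : ℕ :=
  sInf {k : ℕ | ∃ D : V → ℤ, (∀ v, 0 ≤ D v) ∧ (∑ v, D v) = (k : ℤ) ∧ WinsGonalityGame G D}

/-- A set of vertices is path-convex if it contains every path between two of its members. -/
def PathConvex {ι : Type*} (T : SimpleGraph ι) (S : Set ι) : Prop :=
  ∀ ⦃x y : ι⦄ (p : T.Walk x y), p.IsPath → x ∈ S → y ∈ S → ∀ z ∈ p.support, z ∈ S

theorem PathConvex.inter {ι : Type*} {T : SimpleGraph ι} {A B : Set ι}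
    (hA : PathConvex T A) (hB : PathConvex T B) : PathConvex T (A ∩ B) :=
  fun _ _ p hp hx hy z hz => ⟨hA p hp hx.1 hy.1 z hz, hB p hp hx.2 hy.2 z hz⟩

/-- In an acyclic graph, preconnected induced subgraphs are path-convex. -/
theorem SimpleGraph.IsAcyclic.pathConvex {ι : Type*} {T : SimpleGraph ι} (hT : T.IsAcyclic)
    {S : Set ι} (hS : (T.induce S).Preconnected) : PathConvex T S := by
  classical
  intro x y p hp hx hy z hz
  obtain ⟨q⟩ := hS ⟨x, hx⟩ ⟨y, hy⟩
  have hpq : p = (q.map (Embedding.induce S).toHom).bypass :=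
    congrArg Subtype.val
      ((isAcyclic_iff_subsingleton_path.mp hT x y).elim ⟨p, hp⟩ ⟨_, Walk.bypass_isPath _⟩)
  rw [hpq] at hz
  have hz' := Walk.support_bypass_subset_support _ hz
  erw [Walk.support_map, List.mem_map] at hz'
  obtain ⟨w, -, rfl⟩ := hz'
  exact w.2

/-- A path from `a` to a path-convex set `A` can be rerouted, at a vertex where it meets `A`,
to a path ending at any prescribed vertex of `A`. -/
theorem PathConvex.exists_rerouted_path {ι : Type*} {T : SimpleGraph ι} (hT : T.Connected)
    {A : Set ι} (hA : PathConvex T A) {b : ι} (hb : b ∈ A) {a c : ι} (p : T.Walk a c)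
    (hp : p.IsPath) (hc : c ∈ A) :
    ∃ x ∈ A, x ∈ p.support ∧ ∃ q : T.Walk a b, q.IsPath ∧ x ∈ q.support ∧
      ∀ y ∈ q.support, y ∈ A ∨ y ∈ p.support := by
  have base : ∀ {a c : ι} (p : T.Walk a c), a ∈ A →
      ∃ x ∈ A, x ∈ p.support ∧ ∃ q : T.Walk a b, q.IsPath ∧ x ∈ q.support ∧
        ∀ y ∈ q.support, y ∈ A ∨ y ∈ p.support := by
    intro a c p ha
    obtain ⟨q, hq⟩ := hT.exists_isPath a b
    exact ⟨a, ha, p.start_mem_support, q, hq, q.start_mem_support,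
      fun y hy => Or.inl (hA q hq ha hb y hy)⟩
  induction p with
  | nil => exact base _ hc
  | @cons u v w h p ih =>
    by_cases hu : u ∈ A
    · exact base _ hu
    · rw [Walk.cons_isPath_iff] at hp
      obtain ⟨x, hxA, hxp, q, hq, hxq, hsub⟩ := ih hp.1 hc
      refine ⟨x, hxA, by simp [hxp], Walk.cons h q, ?_, by simp [hxq], ?_⟩
      · rw [Walk.cons_isPath_iff]
        exact ⟨hq, fun hmem => (hsub u hmem).elim hu hp.2⟩
      · intro y hy
        rw [Walk.support_cons, List.mem_cons] at hy ⊢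
        rcases hy with rfl | hy
        · exact Or.inr (Or.inl rfl)
        · exact (hsub y hy).imp_right Or.inr

theorem PathConvex.inter_inter_nonempty {ι : Type*} {T : SimpleGraph ι} (hT : T.Connected)
    {A B C : Set ι} (hA : PathConvex T A) (hB : PathConvex T B) (hC : PathConvex T C)
    (hBC : (B ∩ C).Nonempty) (hAC : (A ∩ C).Nonempty) (hAB : (A ∩ B).Nonempty) :
    (A ∩ B ∩ C).Nonempty := by
  obtain ⟨a, haB, haC⟩ := hBC
  obtain ⟨b, hbA, hbC⟩ := hAC
  obtain ⟨c, hcA, hcB⟩ := hAB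
  obtain ⟨p, hp⟩ := hT.exists_isPath a c
  obtain ⟨x, hxA, hxp, q, hq, hxq, -⟩ := hA.exists_rerouted_path hT hbA p hp hcA
  exact ⟨x, ⟨hxA, hB p hp haB hcB x hxp⟩, hC q hq haC hbC x hxq⟩

/-- The Helly property for path-convex sets in a connected graph. -/
theorem PathConvex.helly {ι κ : Type*} {T : SimpleGraph ι} (hT : T.Connected)
    {s : Finset κ} (hs : s.Nonempty) (F : κ → Set ι) (hF : ∀ i ∈ s, PathConvex T (F i))
    (hpair : ∀ i ∈ s, ∀ j ∈ s, (F i ∩ F j).Nonempty) :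
    ∃ t, ∀ i ∈ s, t ∈ F i := by
  induction hs using Finset.Nonempty.cons_induction generalizing F with
  | singleton a =>
    obtain ⟨t, ht, -⟩ := hpair a (by simp) a (by simp)
    exact ⟨t, by simpa using ht⟩
  | cons a s has hs ih =>
    simp only [Finset.mem_cons, forall_eq_or_imp] at hF hpair ⊢
    obtain ⟨t, ht⟩ := ih (fun i => F i ∩ F a) (fun i hi => (hF.2 i hi).inter hF.1) (by
      intro i hi j hj
      obtain ⟨x, ⟨hxi, hxj⟩, hxa⟩ := PathConvex.inter_inter_nonempty hT (hF.2 i hi)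
        (hF.2 j hj) hF.1 (hpair.2 j hj).1 (hpair.2 i hi).1 ((hpair.2 i hi).2 j hj)
      exact ⟨x, ⟨hxi, hxa⟩, hxj, hxa⟩)
    obtain ⟨i, hi⟩ := hs
    exact ⟨t, (ht i hi).2, fun j hj => (ht j hj).1⟩

/-- The nodes whose bags meet a connected vertex set form a path-convex set of the tree. -/
theorem TreeDecomp.pathConvex_meets {V : Type*} {G : SimpleGraph V} (D : TreeDecomp G)
    {B : Set V} (hB : (G.induce B).Preconnected) :
    PathConvex D.tree {t | ∃ v ∈ B, v ∈ D.bag t} := by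
  apply D.isTree.isAcyclic.pathConvex
  have same : ∀ v (hv : v ∈ B) s t (hs : v ∈ D.bag s) (ht : v ∈ D.bag t),
      (D.tree.induce {t | ∃ v ∈ B, v ∈ D.bag t}).Reachable ⟨s, v, hv, hs⟩ ⟨t, v, hv, ht⟩ := by
    intro v hv s t hs ht
    have hsub : {t | v ∈ D.bag t} ≤ {t | ∃ v ∈ B, v ∈ D.bag t} := fun r hr => ⟨v, hv, hr⟩
    exact ((D.bag_conn v).preconnected ⟨s, hs⟩ ⟨t, ht⟩).map
      (induceHomOfLE D.tree hsub).toHom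
  have along : ∀ {u v : B} (_ : (G.induce B).Walk u v) (s t) (hs : u.1 ∈ D.bag s)
      (ht : v.1 ∈ D.bag t),
      (D.tree.induce {t | ∃ v ∈ B, v ∈ D.bag t}).Reachable
        ⟨s, u.1, u.2, hs⟩ ⟨t, v.1, v.2, ht⟩ := by
    intro u v p
    induction p with
    | @nil u => exact fun s t hs ht => same _ u.2 s t hs ht
    | @cons u v w h p ih =>
      intro s t hs ht
      obtain ⟨r, hur, hvr⟩ := D.bag_edge (show G.Adj u.1 v.1 from h)
      exact (same _ u.2 s r hs hur).trans (ih r t hvr ht)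
  rintro ⟨s, u, hu, hus⟩ ⟨t, v, hv, hvt⟩
  obtain ⟨p⟩ := hB ⟨u, hu⟩ ⟨v, hv⟩
  exact along p s t hus hvt

/-- Some bag of a tree decomposition meets every member of a finite family of connected,
pairwise intersecting or adjacent vertex sets. -/
theorem TreeDecomp.exists_bag_meets {V κ : Type*} [Fintype κ] [Nonempty κ]
    {G : SimpleGraph V} (D : TreeDecomp G) (B : κ → Set V)
    (hconn : ∀ i, (G.induce (B i)).Preconnected)
    (htouch : ∀ i j, ∃ u ∈ B i, ∃ v ∈ B j, u = v ∨ G.Adj u v) :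
    ∃ t, ∀ i, ∃ v ∈ B i, v ∈ D.bag t := by
  obtain ⟨t, ht⟩ := PathConvex.helly D.isTree.connected (Finset.univ_nonempty (α := κ))
    (fun i => {t | ∃ v ∈ B i, v ∈ D.bag t}) (fun i _ => D.pathConvex_meets (hconn i)) (by
      intro i _ j _
      obtain ⟨u, hu, v, hv, rfl | huv⟩ := htouch i j
      · obtain ⟨t, ht⟩ := D.bag_cover u
        exact ⟨t, ⟨u, hu, ht⟩, u, hv, ht⟩
      · obtain ⟨t, hut, hvt⟩ := D.bag_edge huv
        exact ⟨t, ⟨u, hu, hut⟩, v, hv, hvt⟩)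
  exact ⟨t, fun i => ht i (Finset.mem_univ i)⟩

theorem exists_treeDecomp_ncard_le {V : Type*} (G : SimpleGraph V) :
    ∃ k, ∃ D : TreeDecomp G, ∀ t, (D.bag t).ncard ≤ k + 1 :=
  ⟨(Set.univ : Set V).ncard,
    { ι := Unit
      tree := ⊥
      isTree := IsTree.of_subsingleton
      bag := fun _ => Set.univ
      bag_cover := fun v => ⟨(), Set.mem_univ v⟩
      bag_edge := fun u v _ => ⟨(), Set.mem_univ u, Set.mem_univ v⟩
      bag_conn := fun v => by
        have : Nonempty {t : Unit | v ∈ (Set.univ : Set V)} := ⟨⟨(), Set.mem_univ v⟩⟩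
        exact ⟨Preconnected.of_subsingleton⟩ },
    fun _ => Nat.le_succ _⟩

/-- A row of the prism together with a cycle from which one vertex is removed. -/
def rowCycle {m n : ℕ} (i a : Fin m) (j : Fin n) : Set (Fin m × Fin n) :=
  {v | v.1 = i ∨ (v.2 = j ∧ v.1 ≠ a)}

theorem cycleGraph_adj_add_one {m : ℕ} (x : Fin (m + 2)) :
    (cycleGraph (m + 2)).Adj x (x + 1) := by
  rw [cycleGraph_adj]
  right
  simp

theorem rowCycle_preconnected {m n : ℕ} {i a : Fin (m + 2)} (hia : i ≠ a) (j : Fin n) :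
    ((stackedPrism (m + 2) n).induce (rowCycle i a j)).Preconnected := by
  set H := (stackedPrism (m + 2) n).induce (rowCycle i a j) with hH
  have row : ∀ y, H.Reachable ⟨(i, y), Or.inl rfl⟩ ⟨(i, j), Or.inl rfl⟩ := by
    intro y
    let f : pathGraph n →g H :=
      { toFun := fun y => ⟨(i, y), Or.inl rfl⟩
        map_rel' := fun {y z} h => by
          simp only [hH, comap_adj, stackedPrism, Function.Embedding.subtype_apply]
          exact boxProd_adj.mpr (Or.inr ⟨h, rfl⟩) }
    exact (pathGraph_preconnected n y j).map f
  have arc : ∀ d : Fin (m + 2), ∀ hd : a + 1 + d ≠ a,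
      H.Reachable ⟨(a + 1, j), Or.inr ⟨rfl, by simp⟩⟩ ⟨(a + 1 + d, j), Or.inr ⟨rfl, hd⟩⟩ := by
    intro d
    induction d using Fin.induction with
    | zero => intro hd; simp
    | succ d ih =>
      intro hd
      have hne : a + 1 + d.castSucc ≠ a := by
        rw [add_assoc, add_comm 1, Fin.coeSucc_eq_succ, Ne, add_eq_left]
        exact Fin.succ_ne_zero d
      refine (ih hne).trans (Adj.reachable ?_)
      simp only [hH, comap_adj, stackedPrism, Function.Embedding.subtype_apply]
      refine boxProd_adj.mpr (Or.inl ⟨?_, rfl⟩)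
      rw [← Fin.coeSucc_eq_succ, ← add_assoc]
      exact cycleGraph_adj_add_one _
  have cyc : ∀ x (hx : x ≠ a), H.Reachable ⟨(a + 1, j), Or.inr ⟨rfl, by simp⟩⟩
      ⟨(x, j), Or.inr ⟨rfl, hx⟩⟩ := by
    intro x hx
    have hxd : a + 1 + (x - (a + 1)) = x := by abel
    simpa only [hxd] using arc (x - (a + 1)) (by rwa [hxd])
  have hub : ∀ v : rowCycle i a j, H.Reachable v ⟨(i, j), Or.inl rfl⟩ := by
    rintro ⟨⟨x, y⟩, rfl | ⟨rfl, hx⟩⟩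
    · exact row y
    · exact (cyc x hx).symm.trans (cyc i hia)
  exact fun u v => (hub u).trans (hub v).symm

theorem rowCycle_touch {m n : ℕ} (i a i' a' : Fin (m + 2)) (j j' : Fin n) :
    ∃ u ∈ rowCycle i a j, ∃ v ∈ rowCycle i' a' j',
      u = v ∨ (stackedPrism (m + 2) n).Adj u v := by
  by_cases h : i = a'
  · subst h
    exact ⟨(i, j'), Or.inl rfl, (i + 1, j'), Or.inr ⟨rfl, by simp⟩,
      Or.inr (boxProd_adj.mpr (Or.inl ⟨cycleGraph_adj_add_one i, rfl⟩))⟩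
  · exact ⟨(i, j'), Or.inl rfl, (i, j'), Or.inr ⟨rfl, h⟩, Or.inl rfl⟩

/-- A set with fewer than `min m (2 * n)` vertices misses some `rowCycle`. -/
theorem exists_rowCycle_disjoint {m n : ℕ} (S : Finset (Fin (m + 2) × Fin n))
    (hm : S.card < m + 2) (hn : S.card < 2 * n) :
    ∃ i a j, i ≠ a ∧ ∀ v ∈ rowCycle i a j, v ∉ S := by
  classical
  obtain ⟨i, hi⟩ : ∃ i, i ∉ S.image Prod.fst := by
    by_contra! h
    have hcard : Fintype.card (Fin (m + 2)) ≤ (S.image Prod.fst).card := by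
      rw [Finset.eq_univ_iff_forall.mpr h, Finset.card_univ]
    rw [Fintype.card_fin] at hcard
    exact absurd (hcard.trans Finset.card_image_le) (by omega)
  have hrow : ∀ y, (i, y) ∉ S := fun y hy => hi (Finset.mem_image.mpr ⟨_, hy, rfl⟩)
  obtain ⟨j, -, hj⟩ := Finset.exists_card_fiber_lt_of_card_lt_mul (s := S)
    (t := (Finset.univ : Finset (Fin n))) (f := Prod.snd) (n := 2)
    (by simpa [mul_comm] using hn)
  have hle : (S.filter fun v => v.2 = j).card ≤ 1 := Nat.lt_succ_iff.mp hj
  rw [Finset.card_le_one] at hle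
  obtain ⟨a, hia, ha⟩ : ∃ a, i ≠ a ∧ ∀ x, (x, j) ∈ S → x = a := by
    by_cases h : ∃ a, (a, j) ∈ S
    · obtain ⟨a, haS⟩ := h
      refine ⟨a, ?_, fun x hx => ?_⟩
      · rintro rfl
        exact hrow j haS
      · exact congrArg Prod.fst (hle (x, j) (by simp [hx]) (a, j) (by simp [haS]))
    · exact ⟨i + 1, by simp, fun x hx => (h ⟨x, hx⟩).elim⟩
  refine ⟨i, a, j, hia, ?_⟩
  rintro ⟨x, y⟩ (hx | ⟨hy, hx⟩) hS
  · obtain rfl : x = i := hx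
    exact hrow y hS
  · obtain rfl : y = j := hy
    exact hx (ha x hS)

theorem le_treewidth_stackedPrism {m n : ℕ} (hn : 0 < n) :
    min (m + 2) (2 * n) - 1 ≤ treewidth (stackedPrism (m + 2) n) := by
  classical
  refine le_csInf (exists_treeDecomp_ncard_le _) ?_
  rintro k ⟨D, hD⟩
  have : Nonempty {p : (Fin (m + 2) × Fin (m + 2)) × Fin n // p.1.1 ≠ p.1.2} :=
    ⟨⟨((0, 1), ⟨0, hn⟩), by simp⟩⟩
  obtain ⟨t, ht⟩ := D.exists_bag_meets
    (fun p : {p : (Fin (m + 2) × Fin (m + 2)) × Fin n // p.1.1 ≠ p.1.2} =>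
      rowCycle p.1.1.1 p.1.1.2 p.1.2)
    (fun p => rowCycle_preconnected p.2 _) (fun p q => rowCycle_touch _ _ _ _ _ _)
  have hk := hD t
  rw [Set.ncard_eq_toFinset_card'] at hk
  by_contra! hlt
  obtain ⟨i, a, j, hia, hdisj⟩ :=
    exists_rowCycle_disjoint (D.bag t).toFinset (by omega) (by omega)
  obtain ⟨v, hv, hvt⟩ := ht ⟨((i, a), j), hia⟩
  exact hdisj v hv (Set.mem_toFinset.mpr hvt)

/-- For `n ≥ 2`, the treewidth of the stacked prism `Y_{2n,n}` is at least `2n − 1`. -/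
theorem stackedPrism_treewidth_square_lower (n : ℕ) (hn : 2 ≤ n) :
    2 * n - 1 ≤ treewidth (stackedPrism (2 * n) n) := by
  obtain ⟨m, hm⟩ : ∃ m, 2 * n = m + 2 := ⟨2 * n - 2, by omega⟩
  have h := le_treewidth_stackedPrism (m := m) (n := n) (by omega)
  rwa [← hm, min_self] at h
end

section
/- If m ≥ 3 and n ≥ 1 with m ≠ 2n, then the divisorial gonality of the stacked prism graph Y_{m,n} equals min{m, 2n}. -/
open SimpleGraph

section Laplacian

variable {V : Type*} [Fintype V] (G : SimpleGraph V)

open Classical in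
/-- The graph Laplacian: the net number of chips leaving `u` when each vertex `w` is fired
`f w` times. -/
noncomputable def firingLap (f : V → ℤ) (u : V) : ℤ :=
  ∑ w, if G.Adj u w then f u - f w else 0

theorem firingLap_add (f g : V → ℤ) : firingLap G (f + g) = firingLap G f + firingLap G g := by
  classical
  funext u
  simp only [firingLap, Pi.add_apply, ← Finset.sum_add_distrib]
  refine Finset.sum_congr rfl fun w _ => ?_
  split_ifs <;> ring

theorem firingLap_zero : firingLap G 0 = 0 := by
  classical
  funext u
  simp [firingLap]

theorem firingLap_neg (f : V → ℤ) : firingLap G (-f) = -firingLap G f := by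
  have h := firingLap_add G f (-f)
  rw [add_neg_cancel, firingLap_zero] at h
  exact (neg_eq_of_add_eq_zero_right h.symm).symm

theorem sum_firingLap (f : V → ℤ) : ∑ u, firingLap G f u = 0 := by
  classical
  have h : ∑ u, firingLap G f u = -∑ u, firingLap G f u := by
    conv_lhs => simp only [firingLap]
    rw [Finset.sum_comm, ← Finset.sum_neg_distrib]
    refine Finset.sum_congr rfl fun u _ => ?_
    rw [firingLap, ← Finset.sum_neg_distrib]
    refine Finset.sum_congr rfl fun w _ => ?_
    simp only [G.adj_comm w u]
    split_ifs <;> ring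
  linarith

open Classical in
theorem fireVertex_eq_sub_firingLap (D : V → ℤ) (v : V) :
    fireVertex G D v = D - firingLap G (Pi.single v 1) := by
  funext u
  simp only [fireVertex, Pi.sub_apply, firingLap]
  by_cases huv : u = v
  · subst huv
    have : ∀ w, (if G.Adj u w then (Pi.single u 1 : V → ℤ) u - (Pi.single u 1 : V → ℤ) w else 0)
        = if G.Adj u w then 1 else 0 := fun w => by
      split_ifs with h
      · simp [h.ne']
      · rfl
    simp only [this, if_true, Finset.sum_boole]
    congr 2
    rw [Set.ncard_eq_toFinset_card']
    congr 1
    ext w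
    simp
  · have : ∀ w, (if G.Adj u w then (Pi.single v 1 : V → ℤ) u - (Pi.single v 1 : V → ℤ) w else 0)
        = if w = v then (if G.Adj u v then -1 else 0) else 0 := fun w => by
      by_cases hw : w = v
      · subst hw
        simp [huv]
      · simp [huv, hw]
    simp only [this, huv, if_false, Finset.sum_ite_eq', Finset.mem_univ, if_true, G.adj_comm v u]
    split_ifs <;> ring

theorem ChipEquiv.exists_firingLap {D D' : V → ℤ} (h : ChipEquiv G D D') :
    ∃ f, D' = D - firingLap G f := by
  classical
  induction h with
  | rel D D' h =>
    obtain ⟨v, rfl⟩ := h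
    exact ⟨_, fireVertex_eq_sub_firingLap G D v⟩
  | refl D => exact ⟨0, by rw [firingLap_zero, sub_zero]⟩
  | symm D D' _ ih =>
    obtain ⟨f, rfl⟩ := ih
    exact ⟨-f, by rw [firingLap_neg]; abel⟩
  | trans D D' D'' _ _ ih ih' =>
    obtain ⟨f, rfl⟩ := ih
    obtain ⟨g, rfl⟩ := ih'
    exact ⟨f + g, by rw [firingLap_add]; abel⟩

theorem chipEquiv_sub_firingLap (D f : V → ℤ) : ChipEquiv G D (D - firingLap G f) := by
  classical
  let S : AddSubgroup (V → ℤ) :=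
    { carrier := {f | ∀ D, ChipEquiv G D (D - firingLap G f)}
      zero_mem' := fun D => by
        rw [firingLap_zero, sub_zero]
        exact .refl D
      add_mem' := fun {f g} hf hg D => by
        have := hg (D - firingLap G f)
        rw [sub_sub, ← firingLap_add] at this
        exact .trans _ _ _ (hf D) this
      neg_mem' := fun {f} hf D => by
        have := hf (D - firingLap G (-f))
        rw [firingLap_neg, sub_neg_eq_add, add_sub_cancel_right] at this
        rw [firingLap_neg, sub_neg_eq_add]
        exact .symm _ _ this }
  have hf : f ∈ S := by
    have hsum : f = ∑ v, f v • (Pi.single v 1 : V → ℤ) := by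
      funext u
      simp [Finset.sum_apply, Pi.single_apply]
    rw [hsum]
    refine S.sum_mem fun v _ => S.zsmul_mem (fun D => ?_) _
    exact .rel _ _ ⟨v, (fireVertex_eq_sub_firingLap G D v).symm⟩
  exact hf D

/-- The firing script that stops firing each vertex `c` rounds early. -/
def truncScript (f : V → ℤ) (c : ℤ) (u : V) : ℤ := max (f u - c) 0

variable {G} {f : V → ℤ} {c : ℤ} {v w : V}

theorem firingLap_truncScript_nonpos (hv : f v ≤ c) : firingLap G (truncScript f c) v ≤ 0 := by
  classical
  refine Finset.sum_nonpos fun w _ => ?_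
  simp only [truncScript]
  split_ifs <;> omega

theorem firingLap_truncScript_neg (hv : f v ≤ c) (hvw : G.Adj v w) (hw : c < f w) :
    firingLap G (truncScript f c) v < 0 := by
  classical
  refine Finset.sum_neg' (fun w _ => ?_) ⟨w, Finset.mem_univ w, ?_⟩
  · simp only [truncScript]
    split_ifs <;> omega
  · simp only [truncScript, hvw, if_true]
    omega

theorem firingLap_truncScript_le (hv : c ≤ f v) :
    firingLap G (truncScript f c) v ≤ firingLap G f v := by
  classical
  refine Finset.sum_le_sum fun w _ => ?_
  simp only [truncScript]
  split_ifs <;> omega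

theorem firingLap_truncScript_of_forall_le (h : ∀ u, c ≤ f u) :
    firingLap G (truncScript f c) = firingLap G f := by
  classical
  funext u
  refine Finset.sum_congr rfl fun w _ => ?_
  have := h u
  have := h w
  simp only [truncScript]
  split_ifs <;> omega

open Classical in
theorem firingLap_truncScript_sub (hv : c < f v) :
    firingLap G (truncScript f c) v - firingLap G (truncScript f (c + 1)) v =
      ∑ w, if G.Adj v w ∧ f w ≤ c then 1 else 0 := by
  rw [firingLap, firingLap, ← Finset.sum_sub_distrib]
  refine Finset.sum_congr rfl fun w _ => ?_
  simp only [truncScript]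
  by_cases hw : G.Adj v w
  · simp only [hw, if_true, true_and]
    split_ifs <;> omega
  · simp [hw]

theorem sub_firingLap_truncScript_nonneg {D : V → ℤ} (hD : ∀ v, 0 ≤ D v)
    (hD' : ∀ v, 0 ≤ D v - firingLap G f v) (c : ℤ) (v : V) :
    0 ≤ D v - firingLap G (truncScript f c) v := by
  rcases le_total (f v) c with h | h
  · linarith [hD v, firingLap_truncScript_nonpos (G := G) h]
  · linarith [hD' v, firingLap_truncScript_le (G := G) h]

theorem WinsGonalityGame.exists_firingLap [DecidableEq V] {D : V → ℤ} (h : WinsGonalityGame G D)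
    (q : V) : ∃ f, (∀ v, 0 ≤ D v - firingLap G f v) ∧ 1 ≤ D q - firingLap G f q := by
  obtain ⟨E, hE, hDE⟩ := h q
  obtain ⟨f, rfl⟩ := hDE.exists_firingLap
  refine ⟨f, fun v => ?_, ?_⟩
  · have := hE v
    simp only [Pi.sub_apply] at this
    split_ifs at this <;> omega
  · have := hE q
    simp only [Pi.sub_apply, if_true] at this
    omega

theorem winsGonalityGame_of_firingLap [DecidableEq V] {D : V → ℤ}
    (h : ∀ q, ∃ f, ∀ v, (if v = q then 1 else 0) ≤ D v - firingLap G f v) :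
    WinsGonalityGame G D := by
  intro q
  obtain ⟨f, hf⟩ := h q
  refine ⟨_, fun v => ?_, chipEquiv_sub_firingLap G _ f⟩
  have := hf v
  simp only [Pi.sub_apply]
  omega

end Laplacian

section BoxProd

variable {V W : Type*} [Fintype V] [Fintype W] (G : SimpleGraph V) (H : SimpleGraph W)

theorem firingLap_boxProd_fst (f : V → ℤ) (p : V × W) :
    firingLap (G □ H) (fun x => f x.1) p = firingLap G f p.1 := by
  classical
  rw [firingLap, firingLap, Fintype.sum_prod_type]
  refine Finset.sum_congr rfl fun v _ => ?_
  rw [Finset.sum_eq_single p.2]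
  · simp [boxProd_adj]
  · intro w _ hw
    by_cases hv : p.1 = v
    · simp [hv]
    · simp [boxProd_adj, hv, hw.symm]
  · simp

theorem firingLap_boxProd_snd (f : W → ℤ) (p : V × W) :
    firingLap (G □ H) (fun x => f x.2) p = firingLap H f p.2 := by
  classical
  rw [firingLap, firingLap, Fintype.sum_prod_type_right]
  refine Finset.sum_congr rfl fun w _ => ?_
  rw [Finset.sum_eq_single p.1]
  · simp [boxProd_adj]
  · intro v _ hv
    by_cases hw : p.2 = w
    · simp [hw]
    · simp [boxProd_adj, hw, hv.symm]
  · simp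

end BoxProd

theorem Fin.sub_one_ne_add_one {k : ℕ} (i : Fin (k + 3)) : i - 1 ≠ i + 1 := by
  intro h
  have := congrArg Fin.val h
  rw [Fin.val_add_one, Fin.coe_sub_one] at this
  simp only [Fin.ext_iff, Fin.val_last, Fin.val_zero] at this
  split_ifs at this <;> omega

theorem firingLap_cycleGraph {k : ℕ} (f : Fin (k + 3) → ℤ) (i : Fin (k + 3)) :
    firingLap (cycleGraph (k + 3)) f i = (f i - f (i - 1)) + (f i - f (i + 1)) := by
  classical
  have hmem : ∀ w, (cycleGraph (k + 3)).Adj i w ↔ w ∈ ({i - 1, i + 1} : Finset _) := fun w => by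
    rw [← cycleGraph_neighborFinset, mem_neighborFinset]
  rw [← Finset.sum_pair (f := fun w => f i - f w) i.sub_one_ne_add_one, firingLap]
  simp only [hmem, Finset.sum_ite_mem, Finset.univ_inter]

theorem firingLap_pathGraph_le {n : ℕ} (c : ℕ) (j : Fin n) :
    firingLap (pathGraph n) (fun i => max ((c : ℤ) - i) 0) j ≤
      (if j.val = 0 then 1 else 0) - (if j.val = c then 1 else 0) := by
  classical
  set f : Fin n → ℤ := fun i => max ((c : ℤ) - i) 0 with hf
  have hsplit : firingLap (pathGraph n) f j =
      (∑ w : Fin n, if j.val + 1 = w.val then f j - f w else 0) +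
        ∑ w : Fin n, if w.val + 1 = j.val then f j - f w else 0 := by
    rw [firingLap, ← Finset.sum_add_distrib]
    refine Finset.sum_congr rfl fun w _ => ?_
    simp only [pathGraph_adj]
    split_ifs <;> omega
  have hnext : (∑ w : Fin n, if j.val + 1 = w.val then f j - f w else 0) ≤
      if j.val < c then 1 else 0 := by
    by_cases hj : j.val + 1 < n
    · rw [Finset.sum_eq_single ⟨j.val + 1, hj⟩]
      · simp only [hf, if_true]
        split_ifs <;> push_cast <;> omega
      · intro w _ hw
        rw [if_neg fun h => hw (Fin.ext h.symm)]
      · simp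
    · rw [Finset.sum_eq_zero fun w _ => if_neg (by omega)]
      split_ifs <;> simp
  have hprev : (∑ w : Fin n, if w.val + 1 = j.val then f j - f w else 0) ≤
      if j.val = 0 ∨ c < j.val then 0 else -1 := by
    by_cases hj : j.val = 0
    · rw [Finset.sum_eq_zero fun w _ => if_neg (by omega)]
      simp [hj]
    · have hjn := j.isLt
      rw [Finset.sum_eq_single ⟨j.val - 1, by omega⟩]
      · have hj' : j.val - 1 + 1 = j.val := by omega
        simp only [hf, hj', if_true]
        split_ifs <;> omega
      · intro w _ hw
        rw [if_neg fun h => hw (Fin.ext (by simp only; omega))]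
      · simp
  rw [hsplit]
  refine (add_le_add hnext hprev).trans ?_
  split_ifs <;> omega

theorem exists_winning_divisor_card_cycle {m n : ℕ} (hn : 1 ≤ n) :
    ∃ D : Fin m × Fin n → ℤ, (∀ v, 0 ≤ D v) ∧ (∑ v, D v) = (m : ℤ) ∧
      WinsGonalityGame (stackedPrism m n) D := by
  classical
  refine ⟨fun p => if p.2.val = 0 then 1 else 0, fun p => ?_, ?_, ?_⟩
  · dsimp only
    split_ifs <;> simp
  · rw [Fintype.sum_prod_type]
    have : ∀ j : Fin n, j.val = 0 ↔ j = ⟨0, hn⟩ := fun j => by simp [Fin.ext_iff]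
    simp [this]
  · refine winsGonalityGame_of_firingLap fun q => ⟨fun p => max ((q.2.val : ℤ) - p.2.val) 0,
      fun p => ?_⟩
    have h := firingLap_boxProd_snd (cycleGraph m) (pathGraph n)
      (fun i => max ((q.2.val : ℤ) - i) 0) p
    have h' := firingLap_pathGraph_le q.2.val p.2
    rw [stackedPrism, h]
    have : (if p = q then (1 : ℤ) else 0) ≤ if p.2.val = q.2.val then 1 else 0 := by
      split_ifs with h1 h2 <;> simp_all
    linarith

theorem exists_winning_divisor_two_mul {k n : ℕ} :
    ∃ D : Fin (k + 3) × Fin n → ℤ, (∀ v, 0 ≤ D v) ∧ (∑ v, D v) = ((2 * n : ℕ) : ℤ) ∧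
      WinsGonalityGame (stackedPrism (k + 3) n) D := by
  classical
  refine ⟨fun p => (if p.1 = 0 then 1 else 0) + if p.1 = Fin.last _ then 1 else 0,
    fun p => ?_, ?_, ?_⟩
  · dsimp only
    split_ifs <;> simp
  · rw [Fintype.sum_prod_type_right]
    simp [Finset.sum_add_distrib]
    ring
  · refine winsGonalityGame_of_firingLap fun q => ⟨fun p =>
      -min (min (p.1.val : ℤ) (k + 2 - p.1.val)) (min (q.1.val : ℤ) (k + 2 - q.1.val)), fun p => ?_⟩
    have h := firingLap_boxProd_fst (cycleGraph (k + 3)) (pathGraph n)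
      (fun i => -min (min (i.val : ℤ) (k + 2 - i.val)) (min (q.1.val : ℤ) (k + 2 - q.1.val))) p
    rw [stackedPrism, h, firingLap_cycleGraph, Fin.val_add_one, Fin.coe_sub_one]
    have hpq : (if p = q then (1 : ℤ) else 0) ≤ if p.1.val = q.1.val then 1 else 0 := by
      split_ifs with h1 h2 <;> simp_all
    refine hpq.trans ?_
    have := p.1.isLt
    have := q.1.isLt
    simp only [Fin.ext_iff, Fin.val_last, Fin.val_zero]
    generalize p.1.val = a at *
    generalize q.1.val = b at *
    split_ifs <;> omega

theorem Fin.forall_of_forall_add_one {k : ℕ} {p : Fin (k + 1) → Prop} {a : Fin (k + 1)} (ha : p a)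
    (h : ∀ i, p i → p (i + 1)) (b : Fin (k + 1)) : p b := by
  have key : ∀ t : ℕ, p (a + Fin.ofNat (k + 1) t) := by
    intro t
    induction t with
    | zero => simpa using ha
    | succ t ih =>
      have : Fin.ofNat (k + 1) (t + 1) = Fin.ofNat (k + 1) t + 1 := by
        ext
        simp [Fin.val_add]
      rw [this, ← add_assoc]
      exact h _ ih
  have := key (b - a).val
  rwa [Fin.ofNat_val_eq_self, add_sub_cancel] at this

theorem SimpleGraph.Preconnected.forall_of_forall_adj {V : Type*} {G : SimpleGraph V}
    (hG : G.Preconnected) {p : V → Prop} {a : V} (ha : p a)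
    (h : ∀ v w, G.Adj v w → p v → p w) (b : V) : p b := by
  obtain ⟨W⟩ := hG a b
  induction W with
  | nil => exact ha
  | cons hadj _ ih => exact ih (h _ _ hadj ha)

/-- Firing `U` on a cycle, for `U` neither empty nor everything, needs at least two chips. -/
theorem two_le_sum_of_cut_cycleGraph {k : ℕ} {d : Fin (k + 3) → ℤ} {U : Fin (k + 3) → Prop}
    [DecidablePred U] (hd : ∀ i, 0 ≤ d i) {a b : Fin (k + 3)} (ha : U a) (hb : ¬U b)
    (hU : ∀ i, U i → (if U (i - 1) then 0 else 1) + (if U (i + 1) then 0 else 1) ≤ d i) :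
    2 ≤ ∑ i, d i := by
  obtain ⟨i, hi, hi'⟩ : ∃ i, U i ∧ ¬U (i + 1) := by
    by_contra! h
    exact hb (Fin.forall_of_forall_add_one ha h b)
  obtain ⟨j, hj, hj'⟩ : ∃ j, U j ∧ ¬U (j - 1) := by
    by_contra! h
    exact Fin.forall_of_forall_add_one (p := fun i => ¬U i) hb
      (fun i hi hi' => hi (by simpa using h _ hi')) a ha
  have h1 := hU i hi
  have h2 := hU j hj
  by_cases hij : i = j
  · subst hij
    rw [if_neg hi', if_neg hj'] at h1
    have := Finset.single_le_sum (fun i _ => hd i) (Finset.mem_univ i)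
    linarith
  · have := Finset.sum_le_univ_sum_of_nonneg (s := {i, j}) hd
    rw [Finset.sum_pair hij] at this
    rw [if_neg hi'] at h1
    rw [if_neg hj'] at h2
    have : (0 : ℤ) ≤ if U (i - 1) then 0 else 1 := by split_ifs <;> simp
    have : (0 : ℤ) ≤ if U (j + 1) then 0 else 1 := by split_ifs <;> simp
    linarith

theorem stackedPrism_adj_snd {m n : ℕ} (i : Fin m) {j j' : Fin n} (h : (pathGraph n).Adj j j') :
    (stackedPrism m n).Adj (i, j) (i, j') := by
  simp [stackedPrism, boxProd_adj, h]

open Classical in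
theorem stackedPrism_cut_le {k n : ℕ} (P : Fin (k + 3) × Fin n → Prop) [DecidablePred P]
    (i : Fin (k + 3)) (j : Fin n) :
    ((if P (i - 1, j) then 1 else 0) + if P (i + 1, j) then 1 else 0 : ℤ) ≤
      ∑ w, if (stackedPrism (k + 3) n).Adj (i, j) w ∧ P w then 1 else 0 := by
  have hne : ((i - 1, j) : Fin (k + 3) × Fin n) ≠ (i + 1, j) := by
    simpa using i.sub_one_ne_add_one
  refine le_trans ?_ (Finset.sum_le_univ_sum_of_nonneg (s := {(i - 1, j), (i + 1, j)})
    fun w => ?_)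
  · rw [Finset.sum_pair hne]
    simp [stackedPrism, boxProd_adj, cycleGraph_adj]
  · split_ifs <;> simp

/-- If the level set `{v | c < f v}` contains one column of the stacked prism and misses another,
then firing it costs at least two chips in each of the `n` cycles. -/
theorem two_mul_le_sum_of_firingLap {k n : ℕ} {D : Fin (k + 3) × Fin n → ℤ}
    {f : Fin (k + 3) × Fin n → ℤ} {c : ℤ} {a b : Fin (k + 3)}
    (hD : ∀ v, 0 ≤ D v) (hf : ∀ v, 0 ≤ D v - firingLap (stackedPrism (k + 3) n) f v)
    (ha : ∀ j, f (a, j) ≤ c) (hb : ∀ j, c < f (b, j)) : 2 * (n : ℤ) ≤ ∑ v, D v := by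
  classical
  set G := stackedPrism (k + 3) n
  set D₁ : Fin (k + 3) × Fin n → ℤ := fun v => D v - firingLap G (truncScript f (c + 1)) v
  have hsum : ∑ v, D₁ v = ∑ v, D v := by
    simp only [D₁, Finset.sum_sub_distrib, sum_firingLap, sub_zero]
  rw [← hsum, Fintype.sum_prod_type_right]
  have hrow : ∀ j : Fin n, 2 ≤ ∑ i, D₁ (i, j) := fun j => by
    refine two_le_sum_of_cut_cycleGraph (U := fun i => c < f (i, j)) (a := b) (b := a)
      (fun i => sub_firingLap_truncScript_nonneg hD hf _ _) (hb j) (not_lt.2 (ha j)) fun i hi => ?_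
    have h1 := (stackedPrism_cut_le (fun w => f w ≤ c) i j).trans_eq
      (firingLap_truncScript_sub (G := G) hi).symm
    have h3 := sub_firingLap_truncScript_nonneg hD hf c (i, j)
    have h4 : ∀ x : ℤ, (if c < x then (0 : ℤ) else 1) = if x ≤ c then 1 else 0 := fun x => by
      split_ifs <;> omega
    simp only [h4, D₁]
    linarith
  calc 2 * (n : ℤ) = ∑ _j : Fin n, 2 := by simp [mul_comm]
    _ ≤ _ := Finset.sum_le_sum fun j _ => hrow j

/-- A divisor of degree less than `2 * n` that misses a column `a` can gain a chip on `a` without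
leaving any column it already meets. -/
theorem exists_firingLap_meets_more_columns {k n : ℕ} {D : Fin (k + 3) × Fin n → ℤ}
    {f : Fin (k + 3) × Fin n → ℤ} {a : Fin (k + 3)} {j₀ : Fin n}
    (hD : ∀ v, 0 ≤ D v) (hf : ∀ v, 0 ≤ D v - firingLap (stackedPrism (k + 3) n) f v)
    (hdeg : ∑ v, D v < 2 * n) (ha : ∀ j, D (a, j) = 0)
    (hq : 1 ≤ D (a, j₀) - firingLap (stackedPrism (k + 3) n) f (a, j₀)) :
    ∃ g, (∀ v, 0 ≤ D v - firingLap (stackedPrism (k + 3) n) g v) ∧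
      (∃ j, D (a, j) - firingLap (stackedPrism (k + 3) n) g (a, j) ≠ 0) ∧
      ∀ b, (∀ j, D (b, j) - firingLap (stackedPrism (k + 3) n) g (b, j) = 0) →
        ∀ j, D (b, j) = 0 := by
  classical
  set G := stackedPrism (k + 3) n with hG
  obtain ⟨c, ⟨j₁, hj₁⟩, hc⟩ := Int.exists_greatest_of_bdd
    (P := fun c => ∃ j, 0 < D (a, j) - firingLap G (truncScript f c) (a, j))
    (by
      obtain ⟨M, hM⟩ := (Set.finite_range f).bddAbove
      refine ⟨M, fun c ⟨j, hj⟩ => ?_⟩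
      by_contra! hcM
      have : truncScript f c = 0 := by
        funext u
        have : f u ≤ M := hM ⟨u, rfl⟩
        simp only [truncScript, Pi.zero_apply]
        omega
      rw [this, firingLap_zero, ha j] at hj
      simp at hj)
    (by
      obtain ⟨M, hM⟩ := (Set.finite_range f).bddBelow
      refine ⟨M, j₀, ?_⟩
      rw [firingLap_truncScript_of_forall_le fun u => hM ⟨u, rfl⟩]
      exact hq)
  have hnn := sub_firingLap_truncScript_nonneg hD hf
  refine ⟨_, hnn c, ⟨j₁, hj₁.ne'⟩, fun b hb j => ?_⟩
  have hpath := pathGraph_preconnected n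
  by_contra hbj
  have hDb : 0 < D (b, j) := lt_of_le_of_ne (hD _) (Ne.symm hbj)
  have hfb : ∀ i, c < f (b, i) := by
    refine hpath.forall_of_forall_adj (a := j) ?_ fun v w hvw hv => ?_
    · by_contra! h
      linarith [hb j, firingLap_truncScript_nonpos (G := G) h]
    · by_contra! h
      linarith [hb w, hD (b, w),
        firingLap_truncScript_neg h (stackedPrism_adj_snd b hvw.symm) hv]
  have hzero : ∀ i, D (a, i) - firingLap G (truncScript f (c + 1)) (a, i) = 0 := fun i => by
    refine le_antisymm ?_ (hnn _ _)
    by_contra! h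
    linarith [hc _ ⟨i, h⟩]
  have hsub : ∀ i, c < f (a, i) →
      (∑ w, if G.Adj (a, i) w ∧ f w ≤ c then (1 : ℤ) else 0) =
        -(D (a, i) - firingLap G (truncScript f c) (a, i)) := fun i hi => by
    rw [← firingLap_truncScript_sub hi]
    linarith [hzero i]
  have hfa : ∀ i, f (a, i) ≤ c := by
    by_contra! h
    obtain ⟨i, hi⟩ := h
    have hall : ∀ i, c < f (a, i) := by
      refine hpath.forall_of_forall_adj hi fun v w hvw hv => ?_
      by_contra! hw
      have h1 := hsub v hv
      have h2 : (0 : ℤ) < ∑ w, if G.Adj (a, v) w ∧ f w ≤ c then 1 else 0 := by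
        refine Finset.sum_pos' (fun w _ => by split_ifs <;> simp) ⟨(a, w), Finset.mem_univ _, ?_⟩
        rw [if_pos ⟨stackedPrism_adj_snd a hvw, hw⟩]
        exact one_pos
      linarith [hnn c (a, v)]
    have h1 := hsub j₁ (hall j₁)
    have h2 : (0 : ℤ) ≤ ∑ w, if G.Adj (a, j₁) w ∧ f w ≤ c then 1 else 0 :=
      Finset.sum_nonneg fun w _ => by split_ifs <;> simp
    linarith
  linarith [two_mul_le_sum_of_firingLap hD hf hfa hfb]

theorem card_cycle_le_of_forall_column {m n : ℕ} {D : Fin m × Fin n → ℤ} (hD : ∀ v, 0 ≤ D v)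
    (h : ∀ i, ∃ j, D (i, j) ≠ 0) : (m : ℤ) ≤ ∑ v, D v := by
  rw [Fintype.sum_prod_type]
  calc (m : ℤ) = ∑ _i : Fin m, 1 := by simp
    _ ≤ _ := Finset.sum_le_sum fun i _ => by
      obtain ⟨j, hj⟩ := h i
      have h1 := Finset.single_le_sum (f := fun j => D (i, j)) (fun j _ => hD (i, j))
        (Finset.mem_univ j)
      have := hD (i, j)
      omega

theorem min_le_sum_of_winsGonalityGame {k n : ℕ} (hn : 1 ≤ n) {D : Fin (k + 3) × Fin n → ℤ}
    (hD : ∀ v, 0 ≤ D v) (hwin : WinsGonalityGame (stackedPrism (k + 3) n) D) :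
    min ((k + 3 : ℕ) : ℤ) (2 * n) ≤ ∑ v, D v := by
  classical
  by_contra! hlt
  rw [lt_min_iff] at hlt
  obtain ⟨g, hg, hmin⟩ := exists_minimalFor_of_wellFoundedLT
    (fun g => ∀ v, 0 ≤ D v - firingLap (stackedPrism (k + 3) n) g v)
    (fun g => (Finset.univ.filter fun i =>
      ∀ j, D (i, j) - firingLap (stackedPrism (k + 3) n) g (i, j) = 0).card)
    ⟨0, by simpa [firingLap_zero] using hD⟩
  set D₁ : Fin (k + 3) × Fin n → ℤ := fun v => D v - firingLap (stackedPrism (k + 3) n) g v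
  have hsum : ∑ v, D₁ v = ∑ v, D v := by
    simp only [D₁, Finset.sum_sub_distrib, sum_firingLap, sub_zero]
  obtain ⟨a, ha⟩ : ∃ a, ∀ j, D₁ (a, j) = 0 := by
    by_contra! h
    linarith [card_cycle_le_of_forall_column hg h, hlt.1]
  obtain ⟨f, hf, hfq⟩ := hwin.exists_firingLap (a, ⟨0, hn⟩)
  have hD₁ : ∀ h v, D₁ v - firingLap (stackedPrism (k + 3) n) h v =
      D v - firingLap (stackedPrism (k + 3) n) (g + h) v := fun h v => by
    simp only [D₁, firingLap_add, Pi.add_apply]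
    ring
  obtain ⟨h, hh, ⟨j, hj⟩, hcol⟩ := exists_firingLap_meets_more_columns (D := D₁) (f := f - g) (a := a)
    (j₀ := ⟨0, hn⟩) hg (fun v => by rw [hD₁, add_sub_cancel]; exact hf v) (hsum ▸ hlt.2) ha
    (by rw [hD₁, add_sub_cancel]; exact hfq)
  simp only [hD₁] at hh hj hcol
  have hlt' : (Finset.univ.filter fun i =>
        ∀ j, D (i, j) - firingLap (stackedPrism (k + 3) n) (g + h) (i, j) = 0).card <
      (Finset.univ.filter fun i =>
        ∀ j, D (i, j) - firingLap (stackedPrism (k + 3) n) g (i, j) = 0).card := by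
    refine Finset.card_lt_card (Finset.ssubset_iff_of_subset ?_ |>.2 ⟨a, ?_, ?_⟩)
    · exact Finset.monotone_filter_right _ fun b _ hb => hcol b hb
    · simpa using ha
    · simpa using ⟨j, hj⟩
  exact hlt'.not_ge (hmin hh hlt'.le)

/-- If `m ≥ 3`, `n ≥ 1` and `m ≠ 2n`, the divisorial gonality of the stacked prism
`Y_{m,n}` equals `min {m, 2n}`. -/
theorem stackedPrism_gonality (m n : ℕ) (hm : 3 ≤ m) (hn : 1 ≤ n) (hmn : m ≠ 2 * n) :
    gonality (stackedPrism m n) = min m (2 * n) := by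
  obtain ⟨k, rfl⟩ := Nat.exists_eq_add_of_le' hm
  refine le_antisymm (le_min (Nat.sInf_le (exists_winning_divisor_card_cycle hn))
    (Nat.sInf_le exists_winning_divisor_two_mul)) ?_
  refine le_csInf ⟨k + 3, exists_winning_divisor_card_cycle hn⟩ ?_
  rintro d ⟨D, hD, hsum, hwin⟩
  have := min_le_sum_of_winsGonalityGame hn hD hwin
  rw [hsum] at this
  exact_mod_cast this
end

section
/- For all m ≥ 3 and n ≥ 1, the divisorial gonality of the stacked prism graph Y_{m,n} is at most min{m, 2n}: the divisor placing one chip on every vertex of one column, and the divisor placing two chips on every vertex of one row, each win the gonality game. -/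
open SimpleGraph

open Classical in
/-- The effect on a divisor of firing every vertex `v` exactly `f v` times. -/
noncomputable def firingEffect {V : Type*} [Fintype V] (G : SimpleGraph V) :
    (V → ℤ) →+ (V → ℤ) where
  toFun f u := ∑ v, if G.Adj u v then f v - f u else 0
  map_zero' := by ext; simp
  map_add' f g := by
    ext u
    simp only [Pi.add_apply, ← Finset.sum_add_distrib]
    refine Finset.sum_congr rfl fun v _ => ?_
    split_ifs <;> ring

open Classical in
theorem firingEffect_apply {V : Type*} [Fintype V] (G : SimpleGraph V) (f : V → ℤ) (u : V) :
    firingEffect G f u = ∑ v, if G.Adj u v then f v - f u else 0 := rfl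

open Classical in
theorem fireVertex_eq_add_firingEffect {V : Type*} [Fintype V] (G : SimpleGraph V)
    (D : V → ℤ) (v : V) :
    fireVertex G D v = D + firingEffect G (Pi.single v 1) := by
  ext u
  rw [Pi.add_apply, firingEffect_apply, fireVertex]
  by_cases h : u = v
  · subst h
    have key : ∀ w, (if G.Adj u w then (Pi.single u 1 : V → ℤ) w - (Pi.single u 1 : V → ℤ) u
        else 0) = -(if G.Adj u w then 1 else 0) := by
      intro w
      split_ifs with hw
      · simp [hw.ne']
      · simp
    simp only [key, Finset.sum_neg_distrib, Finset.sum_boole, if_true]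
    rw [Set.ncard_eq_toFinset_card']
    have : (G.neighborSet u).toFinset = Finset.univ.filter (G.Adj u) := by ext; simp
    rw [this]
    ring
  · have key : ∀ w, (if G.Adj u w then (Pi.single v 1 : V → ℤ) w - (Pi.single v 1 : V → ℤ) u
        else 0) = if w = v then (if G.Adj v u then 1 else 0) else 0 := by
      intro w
      by_cases hw : w = v
      · subst hw
        simp [h, G.adj_comm]
      · simp [hw, h]
    simp only [key, Finset.sum_ite_eq', Finset.mem_univ, if_true, if_neg h]
    split_ifs <;> simp

theorem chipEquiv_add_firingEffect {V : Type*} [Fintype V] (G : SimpleGraph V)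
    (D f : V → ℤ) : ChipEquiv G D (D + firingEffect G f) := by
  classical
  have single : ∀ (v : V) (k : ℤ) (D : V → ℤ),
      ChipEquiv G D (D + firingEffect G (k • Pi.single v 1)) := by
    intro v k
    induction k using Int.induction_on with
    | zero => intro D; rw [zero_smul, map_zero, add_zero]; exact .refl D
    | succ k ih =>
      intro D
      refine (ih D).trans _ _ _ (.rel _ _ ⟨v, ?_⟩)
      rw [fireVertex_eq_add_firingEffect, add_assoc, ← map_add, add_smul, one_smul]
    | pred k ih =>
      intro D
      refine (ih D).trans _ _ _ (.symm _ _ (.rel _ _ ⟨v, ?_⟩))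
      rw [fireVertex_eq_add_firingEffect, add_assoc, ← map_add, sub_smul, one_smul,
        sub_add_cancel]
  have partialSum : ∀ s : Finset V,
      ChipEquiv G D (D + firingEffect G (∑ v ∈ s, f v • Pi.single v 1)) := by
    intro s
    induction s using Finset.induction_on with
    | empty => rw [Finset.sum_empty, map_zero, add_zero]; exact .refl D
    | insert v s hv ih =>
      refine ih.trans _ _ _ ?_
      rw [Finset.sum_insert hv, add_comm (f v • _), map_add, ← add_assoc]
      exact single _ _ _
  have hf : ∑ v, f v • (Pi.single v 1 : V → ℤ) = f := by
    ext u
    simp [Finset.sum_apply, Pi.single_apply]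
  simpa only [hf] using partialSum Finset.univ

/-- A divisor wins the gonality game if every vertex can be covered by a chip after firing,
without creating debt. -/
theorem winsGonalityGame_of_firing {V : Type*} [Fintype V] [DecidableEq V] {G : SimpleGraph V}
    {D : V → ℤ} (h : ∀ q, ∃ f : V → ℤ, (∀ v, 0 ≤ D v + firingEffect G f v) ∧
      1 ≤ D q + firingEffect G f q) : WinsGonalityGame G D := by
  intro q
  obtain ⟨f, hf, hq⟩ := h q
  refine ⟨_, fun v => ?_, chipEquiv_add_firingEffect G _ f⟩
  rw [Pi.add_apply]
  have := hf v
  split_ifs with hv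
  · subst hv; lia
  · lia

theorem firingEffect_boxProd_fst {α β : Type*} [Fintype α] [Fintype β] (G : SimpleGraph α)
    (H : SimpleGraph β) (f : α → ℤ) (u : α × β) :
    firingEffect (G □ H) (fun v => f v.1) u = firingEffect G f u.1 := by
  classical
  rw [firingEffect_apply, firingEffect_apply, Fintype.sum_prod_type]
  refine Finset.sum_congr rfl fun x _ => ?_
  rw [← Finset.sum_ite_eq' Finset.univ u.2 (fun _ => if G.Adj u.1 x then f x - f u.1 else 0)
    |>.trans (if_pos (Finset.mem_univ _))]
  refine Finset.sum_congr rfl fun y _ => ?_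
  rw [boxProd_adj]
  grind

theorem firingEffect_boxProd_snd {α β : Type*} [Fintype α] [Fintype β] (G : SimpleGraph α)
    (H : SimpleGraph β) (f : β → ℤ) (u : α × β) :
    firingEffect (G □ H) (fun v => f v.2) u = firingEffect H f u.2 := by
  classical
  rw [firingEffect_apply, firingEffect_apply, Fintype.sum_prod_type_right]
  refine Finset.sum_congr rfl fun y _ => ?_
  rw [← Finset.sum_ite_eq' Finset.univ u.1 (fun _ => if H.Adj u.2 y then f y - f u.2 else 0)
    |>.trans (if_pos (Finset.mem_univ _))]
  refine Finset.sum_congr rfl fun x _ => ?_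
  rw [boxProd_adj]
  grind

theorem firingEffect_pathGraph {n : ℕ} (f : ℕ → ℤ) (j : Fin n) :
    firingEffect (pathGraph n) (fun i => f i) j =
      (if j.val + 1 < n then f (j + 1) - f j else 0) +
        (if 0 < j.val then f (j - 1) - f j else 0) := by
  classical
  have split : ∀ i : Fin n, (if (pathGraph n).Adj j i then f i - f j else 0) =
      (if i.val = j.val + 1 then f (j + 1) - f j else 0) +
        (if i.val + 1 = j.val then f (j - 1) - f j else 0) := by
    intro i
    rw [pathGraph_adj]
    grind
  rw [firingEffect_apply, Finset.sum_congr rfl fun i _ => split i, Finset.sum_add_distrib]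
  congr 1
  · split_ifs with h
    · rw [Finset.sum_eq_single ⟨j + 1, h⟩] <;> simp [Fin.ext_iff]
      lia
    · exact Finset.sum_eq_zero fun i _ => if_neg (by lia)
  · split_ifs with h
    · rw [Finset.sum_eq_single ⟨j - 1, by lia⟩] <;> simp [Fin.ext_iff] <;> lia
    · exact Finset.sum_eq_zero fun i _ => if_neg (by lia)

/-- Firing along a path moves a chip from `c` to `d`. -/
theorem firingEffect_pathGraph_min {n : ℕ} (c d j : Fin n) :
    firingEffect (pathGraph n)
        (fun i => ((min i.val c.val : ℕ) : ℤ) - ((min i.val d.val : ℕ) : ℤ)) j =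
      (if j = d then 1 else 0) - (if j = c then 1 else 0) := by
  rw [firingEffect_pathGraph
    (fun i => ((min i c.val : ℕ) : ℤ) - ((min i d.val : ℕ) : ℤ))]
  simp only [Fin.ext_iff]
  grind

theorem firingEffect_cycleGraph {m : ℕ} [NeZero m] (hm : 3 ≤ m) (f : Fin m → ℤ) (i : Fin m) :
    firingEffect (cycleGraph m) f i = f (i + 1) + f (i - 1) - 2 * f i := by
  classical
  have hne : i + 1 ≠ i - 1 := by
    intro h
    have h2 : (1 + 1 : Fin m) = 0 := by
      have := congrArg (· - i + 1) h
      simpa using this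
    have := congrArg Fin.val h2
    simp [Fin.val_add, Nat.mod_eq_of_lt (show 1 < m by lia),
      Nat.mod_eq_of_lt (show 2 < m by lia)] at this
  have adj : ∀ j, (cycleGraph m).Adj i j ↔ j = i + 1 ∨ j = i - 1 := by
    intro j
    obtain ⟨k, rfl⟩ : ∃ k, m = k + 2 := ⟨m - 2, by lia⟩
    rw [cycleGraph_adj, or_comm, sub_eq_iff_eq_add', sub_eq_iff_eq_add,
      eq_sub_iff_add_eq, eq_comm (a := i), add_comm 1 j]
  have split : ∀ j, (if j = i + 1 ∨ j = i - 1 then f j - f i else 0) =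
      (if j = i + 1 then f j - f i else 0) + (if j = i - 1 then f j - f i else 0) := by
    grind
  simp only [firingEffect_apply, adj, split, Finset.sum_add_distrib]
  simp only [Finset.sum_ite_eq', Finset.mem_univ, if_true]
  ring

/-- Two chips at a vertex `r` of a cycle can be moved apart symmetrically until one of them
reaches `s`. -/
theorem exists_firing_cycleGraph {m : ℕ} (hm : 3 ≤ m) (r s : Fin m) :
    ∃ f : Fin m → ℤ, (∀ i, 0 ≤ (if i = r then 2 else 0) + firingEffect (cycleGraph m) f i) ∧
      1 ≤ (if s = r then 2 else 0) + firingEffect (cycleGraph m) f s := by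
  have : NeZero m := ⟨by lia⟩
  set k : ℕ := min (s - r).val (m - (s - r).val) with hk
  let h : ℕ → ℤ := fun x => -((min (min x (m - x)) k : ℕ) : ℤ)
  have effect : ∀ i, firingEffect (cycleGraph m) (fun i => h (i - r).val) i =
      h (if (i - r).val + 1 = m then 0 else (i - r).val + 1) +
        h (if (i - r).val = 0 then m - 1 else (i - r).val - 1) - 2 * h (i - r).val := by
    intro i
    have succ : (i + 1 - r).val = if (i - r).val + 1 = m then 0 else (i - r).val + 1 := by
      rw [add_sub_right_comm]
      generalize i - r = x
      obtain ⟨l, rfl⟩ : ∃ l, m = l + 1 := ⟨m - 1, by lia⟩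
      rw [Fin.val_add_one]
      simp [Fin.ext_iff]
    have pred : (i - 1 - r).val = if (i - r).val = 0 then m - 1 else (i - r).val - 1 := by
      rw [sub_right_comm]
      generalize i - r = x
      obtain ⟨l, rfl⟩ : ∃ l, m = l + 1 := ⟨m - 1, by lia⟩
      have hx := Fin.val_add_one (x - 1)
      rw [sub_add_cancel] at hx
      simp only [Fin.ext_iff, Fin.val_last] at hx
      have := (x - 1).isLt
      split_ifs at hx ⊢ <;> lia
    rw [firingEffect_cycleGraph hm, succ, pred]
  have eq_iff : ∀ i, i = r ↔ (i - r).val = 0 := by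
    intro i
    rw [Fin.val_eq_zero_iff, sub_eq_zero]
  refine ⟨fun i => h (i - r).val, fun i => ?_, ?_⟩
  · simp only [effect, eq_iff i]
    have hi := (i - r).isLt
    have hs := (s - r).isLt
    generalize (i - r).val = x at *
    generalize (s - r).val = y at *
    simp only [h]
    clear_value k
    split_ifs <;> lia
  · simp only [effect, eq_iff s]
    have hs := (s - r).isLt
    generalize (s - r).val = y at *
    simp only [h]
    clear_value k
    split_ifs <;> lia

theorem winsGonalityGame_column (m n : ℕ) (c : Fin n) :
    WinsGonalityGame (stackedPrism m n) (fun v => if v.2 = c then 1 else 0) := by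
  refine winsGonalityGame_of_firing fun q =>
    ⟨fun v => ((min v.2.val c.val : ℕ) : ℤ) - ((min v.2.val q.2.val : ℕ) : ℤ),
      fun v => ?_, ?_⟩
  all_goals
    rw [stackedPrism, firingEffect_boxProd_snd _ _
      (fun i : Fin n => ((min i.val c.val : ℕ) : ℤ) - ((min i.val q.2.val : ℕ) : ℤ)),
      firingEffect_pathGraph_min]
    split_ifs <;> simp_all

theorem winsGonalityGame_row (m n : ℕ) (hm : 3 ≤ m) (r : Fin m) :
    WinsGonalityGame (stackedPrism m n) (fun v => if v.1 = r then 2 else 0) := by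
  refine winsGonalityGame_of_firing fun q => ?_
  obtain ⟨f, hf, hq⟩ := exists_firing_cycleGraph hm r q.1
  refine ⟨fun v => f v.1, fun v => ?_, ?_⟩
  · rw [stackedPrism, firingEffect_boxProd_fst]
    exact hf v.1
  · rw [stackedPrism, firingEffect_boxProd_fst]
    exact hq

/-- For `m ≥ 3`, `n ≥ 1`, the gonality of the stacked prism `Y_{m,n}` is at most
`min {m, 2n}`: the divisor with one chip on every vertex of one column, and the divisor
with two chips on every vertex of one row, each win the gonality game. -/
theorem stackedPrism_gonality_upper (m n : ℕ) (hm : 3 ≤ m) (hn : 1 ≤ n) :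
    gonality (stackedPrism m n) ≤ min m (2 * n) ∧
      (∀ c : Fin n, WinsGonalityGame (stackedPrism m n)
        (fun v => if v.2 = c then 1 else 0)) ∧
      (∀ r : Fin m, WinsGonalityGame (stackedPrism m n)
        (fun v => if v.1 = r then 2 else 0)) := by
  have column := winsGonalityGame_column m n
  have row := winsGonalityGame_row m n hm
  refine ⟨le_min (Nat.sInf_le ⟨_, ?_, ?_, column ⟨0, hn⟩⟩)
    (Nat.sInf_le ⟨_, ?_, ?_, row ⟨0, by lia⟩⟩), column, row⟩
  · intro v
    positivity
  · rw [Fintype.sum_prod_type]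
    simp
  · intro v
    positivity
  · rw [Fintype.sum_prod_type_right]
    simp [mul_comm]
end

section
/- For all m, n ≥ 3, the divisorial gonality of the toroidal grid graph T_{m,n} is at most 2·min{m, n}: the divisor placing two chips on every vertex of one row, and the divisor placing two chips on every vertex of one column, each win the gonality game. -/
open SimpleGraph

/-- The principal divisor added by a single chip-firing move at `v`. -/
noncomputable def firingVector {V : Type*} (G : SimpleGraph V) (v : V) : V → ℤ :=
  fireVertex G 0 v

lemma fireVertex_eq_add {V : Type*} (G : SimpleGraph V) (D : V → ℤ) (v : V) :
    fireVertex G D v = D + firingVector G v := by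
  funext u
  simp only [fireVertex, firingVector, Pi.add_apply, Pi.zero_apply]
  split_ifs <;> ring

/-- The principal divisors of `G`: those whose addition does not change the class of any
divisor. -/
def principalDivisors {V : Type*} (G : SimpleGraph V) : AddSubgroup (V → ℤ) where
  carrier := {f | ∀ D, ChipEquiv G D (D + f)}
  zero_mem' D := by
    rw [add_zero]
    exact .refl D
  add_mem' {f g} hf hg D := by
    rw [← add_assoc]
    exact .trans _ _ _ (hf D) (hg (D + f))
  neg_mem' {f} hf D := by
    have h := hf (D + -f)
    rw [neg_add_cancel_right] at h
    exact .symm _ _ h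

lemma firingVector_mem_principalDivisors {V : Type*} (G : SimpleGraph V) (v : V) :
    firingVector G v ∈ principalDivisors G :=
  fun D => .rel _ _ ⟨v, (fireVertex_eq_add G D v).symm⟩

lemma winsGonalityGame_of_sub_mem {V : Type*} [DecidableEq V] {G : SimpleGraph V} {D : V → ℤ}
    (h : ∀ q, ∃ E : V → ℤ, (∀ v, 0 ≤ E v) ∧ 1 ≤ E q ∧ E - D ∈ principalDivisors G) :
    WinsGonalityGame G D := by
  intro q
  obtain ⟨E, hE, hq, hmem⟩ := h q
  refine ⟨fun v => E v - if v = q then 1 else 0, fun v => ?_, ?_⟩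
  · beta_reduce
    split_ifs with hv
    · subst hv
      linarith
    · simpa using hE v
  · convert hmem (fun v => D v - if v = q then 1 else 0) using 1
    funext v
    simp only [Pi.add_apply, Pi.sub_apply]
    ring

/-- If all second differences of `s` lie in a subgroup `H`, then so do all symmetric second
differences with integral step. -/
lemma symmetric_difference_mem {A M : Type*} [AddCommGroup A] [AddCommGroup M]
    (H : AddSubgroup M) (s : A → M) (e : A)
    (hs : ∀ a, s (a + e) + s (a - e) - (s a + s a) ∈ H) (a : A) (k : ℕ) :
    s (a + k • e) + s (a - k • e) - (s a + s a) ∈ H := by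
  have first : ∀ (b : A) (k : ℕ),
      (s (b + k • e + e) - s (b + k • e)) - (s (b + e) - s b) ∈ H := by
    intro b k
    induction k with
    | zero => simp
    | succ k ih =>
      have h := H.add_mem ih (hs (b + (k + 1) • e))
      have e1 : b + (k + 1) • e - e = b + k • e := by rw [succ_nsmul]; abel
      have e2 : b + k • e + e = b + (k + 1) • e := by rw [succ_nsmul]; abel
      rw [e1, e2] at h
      convert h using 1
      abel
  induction k with
  | zero => simp
  | succ k ih =>
    have h := H.add_mem ih (first (a - (k + 1) • e) (2 * k + 1))
    have e1 : a - (k + 1) • e + (2 * k + 1) • e = a + k • e := by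
      simp only [add_nsmul, two_mul]; abel
    have e2 : a - (k + 1) • e + e = a - k • e := by rw [succ_nsmul]; abel
    have e3 : a + k • e + e = a + (k + 1) • e := by rw [succ_nsmul]; abel
    rw [e1, e2, e3] at h
    convert h using 1
    abel

lemma cycleGraph_adj_iff_add_sub (k : ℕ) (a x : Fin (k + 3)) :
    (cycleGraph (k + 3)).Adj a x ↔ x = a + 1 ∨ x = a - 1 := by
  have h1 : a - x = 1 ↔ x = a - 1 :=
    ⟨fun h => by rw [← h]; abel, fun h => by rw [h]; abel⟩
  have h2 : x - a = 1 ↔ x = a + 1 :=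
    ⟨fun h => by rw [← h]; abel, fun h => by rw [h]; abel⟩
  rw [cycleGraph_adj, h1, h2, or_comm]

lemma fin_sub_one_ne_add_one (k : ℕ) (x : Fin (k + 3)) : x - 1 ≠ x + 1 := by
  intro h
  have h' : (1 : Fin (k + 3)) + 1 = 0 := by
    have h'' : (x + 1) - (x - 1) = 0 := by rw [h, sub_self]
    rw [← h'']
    abel
  simp [Fin.ext_iff, Fin.val_add, Nat.mod_eq_of_lt] at h'

lemma ncard_neighborSet_toroidalGrid (m n : ℕ) (v : Fin (m + 3) × Fin (n + 3)) :
    ((toroidalGrid (m + 3) (n + 3)).neighborSet v).ncard = 4 := by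
  classical
  rw [← Nat.card_coe_set_eq, Nat.card_eq_fintype_card, card_neighborSet_eq_degree]
  unfold toroidalGrid
  rw [degree_boxProd, cycleGraph_degree_three_le, cycleGraph_degree_three_le]

lemma firingVector_toroidalGrid (m n : ℕ) (v : Fin (m + 3) × Fin (n + 3)) :
    firingVector (toroidalGrid (m + 3) (n + 3)) v =
      Pi.single (v.1 + 1, v.2) 1 + Pi.single (v.1 - 1, v.2) 1 + Pi.single (v.1, v.2 + 1) 1 +
        Pi.single (v.1, v.2 - 1) 1 - 4 • Pi.single v 1 := by
  obtain ⟨a, b⟩ := v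
  funext ⟨x, y⟩
  have hadj : (toroidalGrid (m + 3) (n + 3)).Adj (a, b) (x, y) ↔
      (x = a + 1 ∨ x = a - 1) ∧ y = b ∨ (y = b + 1 ∨ y = b - 1) ∧ x = a := by
    rw [toroidalGrid, boxProd_adj, cycleGraph_adj_iff_add_sub, cycleGraph_adj_iff_add_sub,
      eq_comm (a := b), eq_comm (a := a)]
  simp only [firingVector, fireVertex, ncard_neighborSet_toroidalGrid, hadj, Pi.add_apply,
    Pi.sub_apply, Pi.smul_apply, Pi.single_apply, Prod.mk.injEq, Pi.zero_apply]
  have ha := fin_sub_one_ne_add_one m a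
  have hb := fin_sub_one_ne_add_one n b
  have ha1 : a - 1 ≠ a := by simp
  have ha2 : a + 1 ≠ a := by simp
  have hb1 : b - 1 ≠ b := by simp
  have hb2 : b + 1 ≠ b := by simp
  generalize a - 1 = a1, a + 1 = a2, b - 1 = b1, b + 1 = b2 at *
  grind

lemma row_second_difference_mem (m n : ℕ) (r : Fin (m + 3)) :
    let s : Fin (m + 3) → Fin (m + 3) × Fin (n + 3) → ℤ := fun i => ∑ c, Pi.single (i, c) 1
    s (r + 1) + s (r - 1) - (s r + s r) ∈
      principalDivisors (toroidalGrid (m + 3) (n + 3)) := by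
  intro s
  have h := AddSubgroup.sum_mem _ fun c (_ : c ∈ Finset.univ) =>
    firingVector_mem_principalDivisors (toroidalGrid (m + 3) (n + 3)) (r, c)
  simp only [firingVector_toroidalGrid, Finset.sum_add_distrib, Finset.sum_sub_distrib,
    ← Finset.smul_sum] at h
  erw [Equiv.sum_comp (Equiv.addRight (1 : Fin (n + 3)))
      (fun c => (Pi.single (r, c) 1 : Fin (m + 3) × Fin (n + 3) → ℤ)),
    Equiv.sum_comp (Equiv.subRight (1 : Fin (n + 3)))
      (fun c => (Pi.single (r, c) 1 : Fin (m + 3) × Fin (n + 3) → ℤ))] at h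
  convert h using 1
  simp only [s]
  abel

lemma column_second_difference_mem (m n : ℕ) (c : Fin (n + 3)) :
    let s : Fin (n + 3) → Fin (m + 3) × Fin (n + 3) → ℤ := fun j => ∑ i, Pi.single (i, j) 1
    s (c + 1) + s (c - 1) - (s c + s c) ∈
      principalDivisors (toroidalGrid (m + 3) (n + 3)) := by
  intro s
  have h := AddSubgroup.sum_mem _ fun i (_ : i ∈ Finset.univ) =>
    firingVector_mem_principalDivisors (toroidalGrid (m + 3) (n + 3)) (i, c)
  simp only [firingVector_toroidalGrid, Finset.sum_add_distrib, Finset.sum_sub_distrib,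
    ← Finset.smul_sum] at h
  erw [Equiv.sum_comp (Equiv.addRight (1 : Fin (m + 3)))
      (fun i => (Pi.single (i, c) 1 : Fin (m + 3) × Fin (n + 3) → ℤ)),
    Equiv.sum_comp (Equiv.subRight (1 : Fin (m + 3)))
      (fun i => (Pi.single (i, c) 1 : Fin (m + 3) × Fin (n + 3) → ℤ))] at h
  convert h using 1
  simp only [s]
  abel

lemma sum_single_row {α β : Type*} [DecidableEq α] [DecidableEq β] [Fintype β] (i : α) :
    (∑ c : β, Pi.single (i, c) 1 : α × β → ℤ) = fun v => if v.1 = i then 1 else 0 := by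
  funext ⟨x, y⟩
  by_cases h : x = i <;> simp [Finset.sum_apply, Pi.single_apply, h]

lemma sum_single_column {α β : Type*} [DecidableEq α] [DecidableEq β] [Fintype α] (j : β) :
    (∑ i : α, Pi.single (i, j) 1 : α × β → ℤ) = fun v => if v.2 = j then 1 else 0 := by
  funext ⟨x, y⟩
  by_cases h : y = j <;> simp [Finset.sum_apply, Pi.single_apply, h]

lemma fin_val_nsmul_one {k : ℕ} (x : Fin (k + 3)) : x.val • (1 : Fin (k + 3)) = x := by
  have h : ∀ j : ℕ, (j • (1 : Fin (k + 3))).val = j % (k + 3) := by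
    intro j
    induction j with
    | zero => simp
    | succ j ih => rw [succ_nsmul, Fin.val_add, ih]; simp
  ext
  rw [h, Nat.mod_eq_of_lt x.isLt]

/-- If the indicators of the fibers of `p` have principal second differences, then twice the
indicator of a fiber wins the gonality game. -/
lemma winsGonalityGame_two_fiber {V : Type*} [DecidableEq V] {G : SimpleGraph V} {k : ℕ}
    (p : V → Fin (k + 3))
    (hs : ∀ a, (fun v => if p v = a + 1 then (1 : ℤ) else 0) +
      (fun v => if p v = a - 1 then 1 else 0) -
      ((fun v => if p v = a then 1 else 0) + fun v => if p v = a then 1 else 0) ∈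
        principalDivisors G) (r : Fin (k + 3)) :
    WinsGonalityGame G (fun v => if p v = r then 2 else 0) := by
  refine winsGonalityGame_of_sub_mem fun q => ?_
  have h := symmetric_difference_mem (principalDivisors G)
    (fun a v => if p v = a then (1 : ℤ) else 0) 1 hs r (p q - r).val
  have hq : r + (p q - r).val • (1 : Fin (k + 3)) = p q := by
    rw [fin_val_nsmul_one]
    abel
  rw [hq] at h
  refine ⟨(fun v => if p v = p q then 1 else 0) +
    (fun v => if p v = r - (p q - r).val • 1 then 1 else 0), fun v => ?_, ?_, ?_⟩
  · simp only [Pi.add_apply]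
    split_ifs <;> norm_num
  · simp only [Pi.add_apply, if_true]
    split_ifs <;> norm_num
  · convert h using 1
    funext v
    simp only [Pi.add_apply, Pi.sub_apply]
    split_ifs <;> rfl

/-- For `m, n ≥ 3`, the gonality of the toroidal grid `T_{m,n}` is at most
`2 · min {m, n}`: the divisor with two chips on every vertex of one row, and the divisor
with two chips on every vertex of one column, each win the gonality game. -/
theorem toroidalGrid_gonality_upper (m n : ℕ) (hm : 3 ≤ m) (hn : 3 ≤ n) :
    gonality (toroidalGrid m n) ≤ 2 * min m n ∧
      (∀ r : Fin m, WinsGonalityGame (toroidalGrid m n)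
        (fun v => if v.1 = r then 2 else 0)) ∧
      (∀ c : Fin n, WinsGonalityGame (toroidalGrid m n)
        (fun v => if v.2 = c then 2 else 0)) := by
  obtain ⟨m, rfl⟩ := Nat.exists_eq_add_of_le' hm
  obtain ⟨n, rfl⟩ := Nat.exists_eq_add_of_le' hn
  have hrow : ∀ r : Fin (m + 3), WinsGonalityGame (toroidalGrid (m + 3) (n + 3))
      (fun v => if v.1 = r then 2 else 0) :=
    winsGonalityGame_two_fiber Prod.fst fun a => by
      simpa only [sum_single_row] using row_second_difference_mem m n a
  have hcol : ∀ c : Fin (n + 3), WinsGonalityGame (toroidalGrid (m + 3) (n + 3))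
      (fun v => if v.2 = c then 2 else 0) :=
    winsGonalityGame_two_fiber Prod.snd fun a => by
      simpa only [sum_single_column] using column_second_difference_mem m n a
  refine ⟨?_, hrow, hcol⟩
  rcases le_total (m + 3) (n + 3) with h | h
  · rw [min_eq_left h]
    refine Nat.sInf_le ⟨_, fun v => ?_, ?_, hcol 0⟩
    · split_ifs <;> norm_num
    · simp [Fintype.sum_prod_type, mul_comm]
  · rw [min_eq_right h]
    refine Nat.sInf_le ⟨_, fun v => ?_, ?_, hrow 0⟩
    · split_ifs <;> norm_num
    · simp [Fintype.sum_prod_type_right, mul_comm]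
end
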